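/- Assume c₀, c₁, c_e > 0. Then lim_{U→∞} G(U) = −c₁ − c_e·(μ_x² + σ_x²). -/

import Mathlib

open MeasureTheory Real Filter Set

/-- κ = σ²/σx² -/
noncomputable def kap (σ σx : ℝ) : ℝ := σ ^ 2 / σx ^ 2

/-- The marginalized likelihood ratio L(U,V). -/
noncomputable def Lf (σ σx μx U V : ℝ) : ℝ :=
  σ / σx / Real.sqrt (U + kap σ σx) *
    Real.exp ((V + μx * kap σ σx) ^ 2 / (2 * σ ^ 2 * (U + kap σ σx)) - μx ^ 2 / (2 * σx ^ 2))

/-- The optimum estimate m(U,V). -/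
noncomputable def mf (σ σx μx U V : ℝ) : ℝ :=
  (V + μx * kap σ σx) / (U + kap σ σx)

/-- ℓ(U,V) = L(U,V)(c₁ + c_e m(U,V)²). -/
noncomputable def ellf (σ σx μx c₁ ce U V : ℝ) : ℝ :=
  Lf σ σx μx U V * (c₁ + ce * (mf σ σx μx U V) ^ 2)

/-- G(U) = ∫ min{0, c₀ − ℓ(U,V)} N(0, σ²U)(dV). -/
noncomputable def Gf (σ σx μx c₀ c₁ ce U : ℝ) : ℝ :=
  ∫ V : ℝ, min 0 (c₀ - ellf σ σx μx c₁ ce U V) *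
    ((Real.sqrt (2 * Real.pi * σ ^ 2 * U))⁻¹ * Real.exp (-V ^ 2 / (2 * σ ^ 2 * U)))

open ProbabilityTheory

/-- A quadratic function is integrable against a real Gaussian measure. -/
lemma integrable_quadratic_gaussianReal (μ : ℝ) (v : NNReal) (A B k b : ℝ) :
    Integrable (fun x ↦ A + B * ((x - μ) * k + b) ^ 2) (gaussianReal μ v) := by
  have h : MemLp (fun x : ℝ ↦ x) 2 (gaussianReal μ v) := memLp_id_gaussianReal 2
  have h' : MemLp (fun x : ℝ ↦ (x - μ) * k + b) 2 (gaussianReal μ v) :=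
    ((h.sub (memLp_const μ)).mul_const k).add (memLp_const b)
  exact (integrable_const A).add (h'.integrable_sq.const_mul B)

/-- The mean of a quadratic function under a real Gaussian measure. -/
lemma integral_quadratic_gaussianReal (μ : ℝ) (v : NNReal) (A B k b : ℝ) :
    ∫ x, A + B * ((x - μ) * k + b) ^ 2 ∂gaussianReal μ v = A + B * (v * k ^ 2 + b ^ 2) := by
  have h : MemLp (fun x : ℝ ↦ x) 2 (gaussianReal μ v) := memLp_id_gaussianReal 2
  have hc : MemLp (fun x : ℝ ↦ x - μ) 2 (gaussianReal μ v) := h.sub (memLp_const μ)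
  have hmean : ∫ x, (x - μ) ∂gaussianReal μ v = 0 := by
    rw [integral_sub (h.integrable (by norm_num)) (integrable_const μ)]
    simp
  have hvar : ∫ x, (x - μ) ^ 2 ∂gaussianReal μ v = v := by
    have := variance_fun_id_gaussianReal (μ := μ) (v := v)
    rwa [variance_eq_integral measurable_id'.aemeasurable, integral_id_gaussianReal] at this
  have hexp : (fun x : ℝ ↦ A + B * ((x - μ) * k + b) ^ 2) = fun x ↦
      (B * k ^ 2) * (x - μ) ^ 2 + ((2 * B * k * b) * (x - μ) + (A + B * b ^ 2)) := by
    ext x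
    ring
  have i₂ : Integrable (fun x ↦ (B * k ^ 2) * (x - μ) ^ 2) (gaussianReal μ v) :=
    hc.integrable_sq.const_mul _
  have i₁ : Integrable (fun x ↦ (2 * B * k * b) * (x - μ)) (gaussianReal μ v) :=
    (hc.integrable (by norm_num)).const_mul _
  have i₀ : Integrable (fun x ↦ (2 * B * k * b) * (x - μ) + (A + B * b ^ 2)) (gaussianReal μ v) :=
    i₁.add (integrable_const _)
  rw [hexp, integral_add i₂ i₀, integral_add i₁ (integrable_const _), integral_const_mul,
    integral_const_mul, hmean, hvar]
  simp
  ring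

lemma kap_pos {σ σx : ℝ} (hσ : 0 < σ) (hσx : 0 < σx) : 0 < kap σ σx := by
  unfold kap
  positivity

lemma ellf_nonneg {σ σx μx c₁ ce : ℝ} (hσ : 0 < σ) (hσx : 0 < σx) (hc₁ : 0 < c₁) (hce : 0 < ce)
    (U V : ℝ) : 0 ≤ ellf σ σx μx c₁ ce U V := by
  unfold ellf Lf
  positivity

/-- Tilting the law `N(0, σ²U)` by the likelihood ratio gives the law
`N(μx U, σx² U (U + κ))`. -/
lemma Lf_mul_gaussianPDFReal {σ σx : ℝ} (hσ : 0 < σ) (hσx : 0 < σx) (μx : ℝ) {U : ℝ} (hU : 0 < U)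
    (V : ℝ) :
    Lf σ σx μx U V * gaussianPDFReal 0 (σ ^ 2 * U).toNNReal V =
      gaussianPDFReal (μx * U) (σx ^ 2 * U * (U + kap σ σx)).toNNReal V := by
  have hκ := kap_pos hσ hσx
  have hκσ : σ ^ 2 = kap σ σx * σx ^ 2 := by
    unfold kap
    field_simp
  unfold Lf gaussianPDFReal
  rw [Real.coe_toNNReal _ (by positivity), Real.coe_toNNReal _ (by positivity)]
  generalize kap σ σx = κ at *
  have hs : √(2 * π * (σx ^ 2 * U * (U + κ))) = √(2 * π * (σ ^ 2 * U)) * √(U + κ) * (σx / σ) := by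
    rw [← Real.sqrt_mul (by positivity), Real.sqrt_eq_iff_eq_sq (by positivity) (by positivity),
      mul_pow, Real.sq_sqrt (by positivity)]
    field_simp
  have he : -(V - μx * U) ^ 2 / (2 * (σx ^ 2 * U * (U + κ))) =
      ((V + μx * κ) ^ 2 / (2 * σ ^ 2 * (U + κ)) - μx ^ 2 / (2 * σx ^ 2)) +
        -(V - 0) ^ 2 / (2 * (σ ^ 2 * U)) := by
    rw [hκσ]
    field_simp
    ring
  rw [hs, he, Real.exp_add]
  field_simp

lemma ellf_mul_gaussianPDFReal {σ σx : ℝ} (hσ : 0 < σ) (hσx : 0 < σx) (μx c₁ ce : ℝ) {U : ℝ}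
    (hU : 0 < U) (V : ℝ) :
    ellf σ σx μx c₁ ce U V * gaussianPDFReal 0 (σ ^ 2 * U).toNNReal V =
      gaussianPDFReal (μx * U) (σx ^ 2 * U * (U + kap σ σx)).toNNReal V *
        (c₁ + ce * ((V - μx * U) * (U + kap σ σx)⁻¹ + μx) ^ 2) := by
  have hκ := kap_pos hσ hσx
  have hm : mf σ σx μx U V = (V - μx * U) * (U + kap σ σx)⁻¹ + μx := by
    unfold mf
    field_simp
    ring
  rw [ellf, mul_right_comm, Lf_mul_gaussianPDFReal hσ hσx μx hU, hm]

lemma integrable_ellf_mul {σ σx : ℝ} (hσ : 0 < σ) (hσx : 0 < σx) (μx c₁ ce : ℝ) {U : ℝ}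
    (hU : 0 < U) :
    Integrable fun V ↦ ellf σ σx μx c₁ ce U V * gaussianPDFReal 0 (σ ^ 2 * U).toNNReal V := by
  have hκ := kap_pos hσ hσx
  have hv : (σx ^ 2 * U * (U + kap σ σx)).toNNReal ≠ 0 := (Real.toNNReal_pos.2 (by positivity)).ne'
  have h := integrable_quadratic_gaussianReal (μx * U) (σx ^ 2 * U * (U + kap σ σx)).toNNReal
    c₁ ce (U + kap σ σx)⁻¹ μx
  rw [gaussianReal_of_var_ne_zero _ hv, integrable_withDensity_iff_integrable_smul'
    (measurable_gaussianPDF _ _) (ae_of_all _ fun _ ↦ gaussianPDF_lt_top)] at h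
  simpa only [ellf_mul_gaussianPDFReal hσ hσx μx c₁ ce hU, toReal_gaussianPDF, smul_eq_mul] using h

lemma integral_ellf_mul {σ σx : ℝ} (hσ : 0 < σ) (hσx : 0 < σx) (μx c₁ ce : ℝ) {U : ℝ}
    (hU : 0 < U) :
    ∫ V, ellf σ σx μx c₁ ce U V * gaussianPDFReal 0 (σ ^ 2 * U).toNNReal V =
      c₁ + ce * (σx ^ 2 * (U / (U + kap σ σx)) + μx ^ 2) := by
  have hκ := kap_pos hσ hσx
  have hv : (σx ^ 2 * U * (U + kap σ σx)).toNNReal ≠ 0 := (Real.toNNReal_pos.2 (by positivity)).ne'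
  have h := integral_quadratic_gaussianReal (μx * U) (σx ^ 2 * U * (U + kap σ σx)).toNNReal
    c₁ ce (U + kap σ σx)⁻¹ μx
  rw [integral_gaussianReal_eq_integral_smul hv, Real.coe_toNNReal _ (by positivity)] at h
  simp only [ellf_mul_gaussianPDFReal hσ hσx μx c₁ ce hU, ← smul_eq_mul (gaussianPDFReal _ _ _)]
  rw [h]
  field_simp

lemma measurable_ellf (σ σx μx c₁ ce U : ℝ) : Measurable (ellf σ σx μx c₁ ce U) := by
  unfold ellf Lf mf
  fun_prop

/-- At the diffusive scale `V = σ√U z` the cost `ℓ(U, V)` vanishes as `U → ∞`. -/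
lemma tendsto_ellf_sqrt_scale {σ σx c₁ ce : ℝ} (hσ : 0 < σ) (hσx : 0 < σx) (μx : ℝ)
    (hc₁ : 0 < c₁) (hce : 0 < ce) (z : ℝ) :
    Tendsto (fun U ↦ ellf σ σx μx c₁ ce U (σ * √U * z)) atTop (nhds 0) := by
  have hκ := kap_pos hσ hσx
  set d := μx * kap σ σx with hd
  set K := σ / σx * Real.exp (z ^ 2 + d ^ 2 / (σ ^ 2 * kap σ σx)) *
    (c₁ + ce * ((2 * σ ^ 2 * z ^ 2 + 2 * d ^ 2 / kap σ σx) / kap σ σx)) with hK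
  have hlim : Tendsto (fun U : ℝ ↦ K / √(U + kap σ σx)) atTop (nhds 0) :=
    Tendsto.const_div_atTop
      (Real.tendsto_sqrt_atTop.comp (tendsto_atTop_add_const_right _ _ tendsto_id)) K
  refine squeeze_zero' (.of_forall fun U ↦ ellf_nonneg hσ hσx hc₁ hce _ _) ?_ hlim
  filter_upwards [eventually_gt_atTop 0] with U hU
  unfold ellf Lf mf
  rw [← hd, hK]
  generalize kap σ σx = κ at *
  have hsq : (σ * √U * z + d) ^ 2 ≤ (U + κ) * (2 * σ ^ 2 * z ^ 2 + 2 * d ^ 2 / κ) := by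
    have h₁ : (σ * √U * z) ^ 2 = σ ^ 2 * U * z ^ 2 := by
      rw [mul_pow, mul_pow, Real.sq_sqrt hU.le]
    have h₂ : (U + κ) * (2 * σ ^ 2 * z ^ 2 + 2 * d ^ 2 / κ) =
        2 * (σ ^ 2 * U * z ^ 2) + 2 * d ^ 2 + (2 * κ * σ ^ 2 * z ^ 2 + 2 * U * d ^ 2 / κ) := by
      field_simp
      ring
    have h₃ : 0 ≤ 2 * κ * σ ^ 2 * z ^ 2 + 2 * U * d ^ 2 / κ := by positivity
    rw [h₂, ← h₁]
    linarith [sq_nonneg (σ * √U * z - d)]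
  have he : (σ * √U * z + d) ^ 2 / (2 * σ ^ 2 * (U + κ)) - μx ^ 2 / (2 * σx ^ 2) ≤
      z ^ 2 + d ^ 2 / (σ ^ 2 * κ) := by
    have h₁ : (σ * √U * z + d) ^ 2 / (2 * σ ^ 2 * (U + κ)) ≤ z ^ 2 + d ^ 2 / (σ ^ 2 * κ) := by
      rw [div_le_iff₀ (by positivity)]
      refine hsq.trans_eq ?_
      field_simp
    have h₂ : 0 ≤ μx ^ 2 / (2 * σx ^ 2) := by positivity
    linarith
  have hm : ((σ * √U * z + d) / (U + κ)) ^ 2 ≤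
      (2 * σ ^ 2 * z ^ 2 + 2 * d ^ 2 / κ) / κ := by
    rw [div_pow, div_le_iff₀ (by positivity)]
    refine hsq.trans ?_
    have h₁ : 0 ≤ (U + κ) * (2 * σ ^ 2 * z ^ 2 + 2 * d ^ 2 / κ) := by positivity
    have h₂ : (2 * σ ^ 2 * z ^ 2 + 2 * d ^ 2 / κ) / κ * (U + κ) ^ 2 =
        (U + κ) * (2 * σ ^ 2 * z ^ 2 + 2 * d ^ 2 / κ) * (1 + U / κ) := by
      field_simp
      ring
    rw [h₂]
    exact le_mul_of_one_le_right h₁ (by linarith [show 0 ≤ U / κ by positivity])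
  calc _ ≤ σ / σx / √(U + κ) * Real.exp (z ^ 2 + d ^ 2 / (σ ^ 2 * κ)) *
        (c₁ + ce * ((2 * σ ^ 2 * z ^ 2 + 2 * d ^ 2 / κ) / κ)) := by gcongr
    _ = _ := by ring

lemma integral_mul_gaussianPDFReal_scale (f : ℝ → ℝ) {σ U : ℝ} (hσ : 0 < σ) (hU : 0 < U) :
    ∫ V, f V * gaussianPDFReal 0 (σ ^ 2 * U).toNNReal V =
      ∫ z, f (σ * √U * z) * gaussianPDFReal 0 1 z := by
  have ha : 0 < σ * √U := by positivity
  have h := Measure.integral_comp_mul_left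
    (fun V ↦ f V * gaussianPDFReal 0 (σ ^ 2 * U).toNNReal V) (σ * √U)
  have hp (z : ℝ) : gaussianPDFReal 0 (σ ^ 2 * U).toNNReal (σ * √U * z) =
      (σ * √U)⁻¹ * gaussianPDFReal 0 1 z := by
    have hU' := Real.sq_sqrt hU.le
    have hs : √(2 * π * (σ ^ 2 * U)) = σ * √U * √(2 * π) := by
      rw [Real.sqrt_eq_iff_eq_sq (by positivity) (by positivity), mul_pow, mul_pow,
        Real.sq_sqrt hU.le, Real.sq_sqrt (by positivity)]
      ring
    have he : -(σ * √U * z) ^ 2 / (2 * (σ ^ 2 * U)) = -z ^ 2 / 2 := by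
      rw [mul_pow, mul_pow, hU']
      field_simp
    simp only [gaussianPDFReal, Real.coe_toNNReal _ (show 0 ≤ σ ^ 2 * U by positivity), sub_zero,
      NNReal.coe_one, mul_one, hs, he, mul_inv]
    ring
  simp only [hp, smul_eq_mul, abs_of_pos (inv_pos.2 ha), mul_left_comm _ (σ * √U)⁻¹] at h
  rw [integral_const_mul] at h
  exact (mul_left_cancel₀ (inv_pos.2 ha).ne' h).symm

/-- The contribution of the truncated cost `min c₀ ℓ` vanishes as `U → ∞`. -/
lemma tendsto_integral_min_ellf {σ σx c₀ c₁ ce : ℝ} (hσ : 0 < σ) (hσx : 0 < σx) (μx : ℝ)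
    (hc₀ : 0 < c₀) (hc₁ : 0 < c₁) (hce : 0 < ce) :
    Tendsto (fun U ↦ ∫ V, min c₀ (ellf σ σx μx c₁ ce U V) *
      gaussianPDFReal 0 (σ ^ 2 * U).toNNReal V) atTop (nhds 0) := by
  have h : Tendsto (fun U ↦ ∫ z, min c₀ (ellf σ σx μx c₁ ce U (σ * √U * z)) *
      gaussianPDFReal 0 1 z) atTop (nhds (∫ _ : ℝ, (0 : ℝ))) := by
    refine tendsto_integral_filter_of_dominated_convergence
      (fun z ↦ c₀ * gaussianPDFReal 0 1 z) (.of_forall fun U ↦ ?_) (.of_forall fun U ↦ ?_)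
      ((integrable_gaussianPDFReal 0 1).const_mul c₀) (ae_of_all _ fun z ↦ ?_)
    · have hm : Measurable fun z ↦ ellf σ σx μx c₁ ce U (σ * √U * z) :=
        (measurable_ellf σ σx μx c₁ ce U).comp (measurable_const_mul _)
      exact ((measurable_const.min hm).mul (measurable_gaussianPDFReal 0 1)).aestronglyMeasurable
    · refine ae_of_all _ fun z ↦ ?_
      have h₁ := gaussianPDFReal_nonneg 0 1 z
      have h₂ := ellf_nonneg (μx := μx) hσ hσx hc₁ hce U (σ * √U * z)
      rw [Real.norm_of_nonneg (mul_nonneg (le_min hc₀.le h₂) h₁)]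
      gcongr
      exact min_le_left _ _
    · have := ((tendsto_const_nhds (x := c₀)).min
        (tendsto_ellf_sqrt_scale hσ hσx μx hc₁ hce z)).mul_const (gaussianPDFReal 0 1 z)
      rwa [min_eq_right hc₀.le, zero_mul] at this
  rw [integral_zero] at h
  refine h.congr' ?_
  filter_upwards [eventually_gt_atTop 0] with U hU
  exact (integral_mul_gaussianPDFReal_scale (fun V ↦ min c₀ (ellf σ σx μx c₁ ce U V)) hσ hU).symm

/-- `G` is the truncated expected cost minus the expected cost. -/
lemma Gf_eq {σ σx c₀ c₁ ce : ℝ} (hσ : 0 < σ) (hσx : 0 < σx) (μx : ℝ)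
    (hc₀ : 0 < c₀) (hc₁ : 0 < c₁) (hce : 0 < ce) {U : ℝ} (hU : 0 < U) :
    Gf σ σx μx c₀ c₁ ce U =
      (∫ V, min c₀ (ellf σ σx μx c₁ ce U V) * gaussianPDFReal 0 (σ ^ 2 * U).toNNReal V) -
        (c₁ + ce * (σx ^ 2 * (U / (U + kap σ σx)) + μx ^ 2)) := by
  have hi := integrable_ellf_mul hσ hσx μx c₁ ce hU
  have hmin : Integrable fun V ↦ min c₀ (ellf σ σx μx c₁ ce U V) *
      gaussianPDFReal 0 (σ ^ 2 * U).toNNReal V := by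
    refine hi.mono' ((measurable_const.min (measurable_ellf σ σx μx c₁ ce U)).mul
      (measurable_gaussianPDFReal 0 _)).aestronglyMeasurable (ae_of_all _ fun V ↦ ?_)
    have h₁ := gaussianPDFReal_nonneg 0 (σ ^ 2 * U).toNNReal V
    have h₂ := ellf_nonneg (μx := μx) hσ hσx hc₁ hce U V
    rw [Real.norm_of_nonneg (mul_nonneg (le_min hc₀.le h₂) h₁)]
    gcongr
    exact min_le_right _ _
  rw [← integral_ellf_mul hσ hσx μx c₁ ce hU, ← integral_sub hmin hi, Gf]
  congr 1 with V
  have hp : (√(2 * π * σ ^ 2 * U))⁻¹ * rexp (-V ^ 2 / (2 * σ ^ 2 * U)) =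
      gaussianPDFReal 0 (σ ^ 2 * U).toNNReal V := by
    rw [gaussianPDFReal, Real.coe_toNNReal _ (by positivity), sub_zero]
    simp only [mul_assoc]
  rw [hp, ← sub_mul, ← min_sub_sub_right, sub_self, min_comm]

/-- lim_{U→∞} G(U) = −c₁ − c_e(μ_x² + σ_x²). -/
theorem G_tendsto_atTop (σ σx μx c₀ c₁ ce : ℝ) (hσ : 0 < σ) (hσx : 0 < σx)
    (hc₀ : 0 < c₀) (hc₁ : 0 < c₁) (hce : 0 < ce) :
    Filter.Tendsto (Gf σ σx μx c₀ c₁ ce) Filter.atTop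
      (nhds (-c₁ - ce * (μx ^ 2 + σx ^ 2))) := by
  have hκ := kap_pos hσ hσx
  have hratio : Tendsto (fun U : ℝ ↦ U / (U + kap σ σx)) atTop (nhds 1) := by
    have h₀ : Tendsto (fun U : ℝ ↦ kap σ σx / (U + kap σ σx)) atTop (nhds 0) :=
      Tendsto.const_div_atTop (tendsto_atTop_add_const_right _ _ tendsto_id) _
    have h₁ := h₀.const_sub 1
    rw [sub_zero] at h₁
    refine h₁.congr' ?_
    filter_upwards [eventually_gt_atTop 0] with U hU
    field_simp
    ring
  have h := (tendsto_integral_min_ellf hσ hσx μx hc₀ hc₁ hce).sub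
    ((((hratio.const_mul (σx ^ 2)).add_const (μx ^ 2)).const_mul ce).const_add c₁)
  rw [show -c₁ - ce * (μx ^ 2 + σx ^ 2) = 0 - (c₁ + ce * (σx ^ 2 * 1 + μx ^ 2)) by ring]
  refine h.congr' ?_
  filter_upwards [eventually_gt_atTop 0] with U hU
  exact (Gf_eq hσ hσx μx hc₀ hc₁ hce hU).symm
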